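/- arXiv:1001.0895 — 2 statements merged into one kernel-verified Lean document; each statement's English description precedes it below -/
import Mathlib

section
/- For every z(0) ∈ D, the differential equation ż(t) = v(z(t)) has a unique solution in D starting from z(0). -/
open Filter

noncomputable section

/-- `pcoef n z j` is `p_j(z) = n (z_j - z_{j+1}) z_{j+1}^(n-1)`. -/
def pcoef (n : ℕ) (z : ℕ → ℝ) (j : ℕ) : ℝ :=
  (n : ℝ) * (z j - z (j + 1)) * z (j + 1) ^ (n - 1)

/-- The `j`-th factor `z_{j+1}^n / (1 - p_j(z))` of `μ(z,·)`,
with the convention that a factor of the form `0/0` equals `1`. -/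
def muFactor (n : ℕ) (z : ℕ → ℝ) (j : ℕ) : ℝ :=
  if z (j + 1) ^ n = 0 ∧ 1 - pcoef n z j = 0 then 1
  else z (j + 1) ^ n / (1 - pcoef n z j)

/-- `mu n z k` is `μ(z,k) = ∏_{j=1}^k z_j^n / (1 - p_{j-1}(z))`. -/
def mu (n : ℕ) (z : ℕ → ℝ) (k : ℕ) : ℝ :=
  ∏ j ∈ Finset.range k, muFactor n z j

/-- The vector field `v_k(z) = λ z_{k-1}^n μ(z,k-1) - λ z_k^n μ(z,k) - (z_k - z_{k+1})`,
meaningful for `k ≥ 1`. -/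
def vfield (lam : ℝ) (n : ℕ) (z : ℕ → ℝ) (k : ℕ) : ℝ :=
  lam * z (k - 1) ^ n * mu n z (k - 1) - lam * z k ^ n * mu n z k - (z k - z (k + 1))

/-- Membership in `D`: non-increasing `[0,1]`-valued summable sequences,
with the convention `z 0 = 1`. -/
def memD (z : ℕ → ℝ) : Prop :=
  z 0 = 1 ∧ (∀ k, z (k + 1) ≤ z k) ∧ (∀ k, 0 ≤ z k ∧ z k ≤ 1) ∧
    Summable (fun k => z (k + 1))

/-- A solution of `ż = v(z)` in `D`: a family of functions `z k : [0,∞) → [0,1]`,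
lying in `D` at each time `t ≥ 0`, differentiable with derivative `v_k(z(t))` for `k ≥ 1`. -/
def IsSolution (lam : ℝ) (n : ℕ) (z : ℕ → ℝ → ℝ) : Prop :=
  (∀ t : ℝ, 0 ≤ t → memD (fun k => z k t)) ∧
  (∀ k : ℕ, 1 ≤ k → ∀ t : ℝ, 0 ≤ t →
    HasDerivWithinAt (z k) (vfield lam n (fun j => z j t) k) (Set.Ici 0) t)

/-- Membership in `D(d)`: `0 ≤ x_d ≤ ⋯ ≤ x_1 ≤ 1` and `x_k = 0` for `k > d`,
with the convention `x 0 = 1`. -/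
def memDd (d : ℕ) (x : ℕ → ℝ) : Prop :=
  x 0 = 1 ∧ (∀ k, x (k + 1) ≤ x k) ∧ (∀ k, 0 ≤ x k ∧ x k ≤ 1) ∧
    (∀ k, d < k → x k = 0)

/-- The truncated vector field `u = u^(d)`. -/
def ufield (lam : ℝ) (n : ℕ) (d : ℕ) (x : ℕ → ℝ) (k : ℕ) : ℝ :=
  if k < d then vfield lam n x k
  else if k = d then
    lam * x (d - 1) ^ n * mu n x (d - 1) - lam * x d ^ n * mu n x d - x d
  else 0

/-- A solution of the truncated system `ẋ = u^(d)(x)` in `D(d)`. -/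
def IsSolutionTrunc (lam : ℝ) (n : ℕ) (d : ℕ) (x : ℕ → ℝ → ℝ) : Prop :=
  (∀ t : ℝ, 0 ≤ t → memDd d (fun k => x k t)) ∧
  (∀ k : ℕ, 1 ≤ k → ∀ t : ℝ, 0 ≤ t →
    HasDerivWithinAt (x k) (ufield lam n d (fun j => x j t) k) (Set.Ici 0) t)

theorem aux_bern (a b : ℝ) (hb : 0 ≤ b) (hab : b ≤ a) (n : ℕ) :
    (n : ℝ) * (a - b) * b ^ (n - 1) ≤ a ^ n - b ^ n := by
  cases n with
  | zero => simp
  | succ m =>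
    simp only [Nat.add_sub_cancel]
    induction m with
    | zero => simp
    | succ m ih =>
      have h1 : 0 ≤ a ^ (m+1) - b ^ (m+1) := sub_nonneg.2 (pow_le_pow_left₀ hb hab _)
      have h2 : b * (((m + 1 : ℕ) : ℝ) * (a - b) * b ^ m) ≤ a * (a ^ (m+1) - b ^ (m+1)) :=
        (mul_le_mul_of_nonneg_left ih hb).trans (mul_le_mul_of_nonneg_right hab h1)
      push_cast at h2 ⊢
      have e : a ^ (m+1+1) - b ^ (m+1+1) = a * (a ^ (m+1) - b ^ (m+1)) + (a-b) * b^(m+1) := by ring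
      rw [e]
      have e2 : ((m:ℝ) + 1 + 1) * (a - b) * b ^ (m + 1)
        = b * (((m:ℝ) + 1) * (a - b) * b ^ m) + (a-b) * b^(m+1) := by ring
      rw [e2]; linarith

theorem aux_pow (a b : ℝ) (ha : 0 ≤ a) (ha1 : a ≤ 1) (hb : 0 ≤ b) (hb1 : b ≤ 1) (n : ℕ) :
    |a ^ n - b ^ n| ≤ n * |a - b| := by
  induction n with
  | zero => simp
  | succ m ih =>
    have e : a ^ (m+1) - b ^ (m+1) = a * (a ^ m - b ^ m) + (a-b) * b^m := by ring
    rw [e]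
    refine (abs_add_le _ _).trans ?_
    rw [abs_mul, abs_mul, abs_of_nonneg ha, abs_of_nonneg (pow_nonneg hb m)]
    have h1 : a * |a ^ m - b ^ m| ≤ |a ^ m - b ^ m| := mul_le_of_le_one_left (abs_nonneg _) ha1
    have h2 : |a - b| * b ^ m ≤ |a - b| := mul_le_of_le_one_right (abs_nonneg _) (pow_le_one₀ hb hb1)
    push_cast; linarith

/-- Monotone sequences with values in `[0,1]` starting at `1`. -/
def memE (z : ℕ → ℝ) : Prop :=
  z 0 = 1 ∧ (∀ k, z (k + 1) ≤ z k) ∧ (∀ k, 0 ≤ z k ∧ z k ≤ 1)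

theorem memE_of_memD {z : ℕ → ℝ} (h : memD z) : memE z := ⟨h.1, h.2.1, h.2.2.1⟩

theorem memE_anti {z : ℕ → ℝ} (h : memE z) {i j : ℕ} (hij : i ≤ j) : z j ≤ z i :=
  antitone_nat_of_succ_le h.2.1 hij

theorem den_ge {n : ℕ} {z : ℕ → ℝ} (h : memE z) (j : ℕ) :
    z (j+1) ^ n ≤ 1 - pcoef n z j := by
  have h1 := aux_bern (z j) (z (j+1)) (h.2.2 _).1 (h.2.1 j) n
  have h2 : z j ^ n ≤ 1 := pow_le_one₀ (h.2.2 _).1 (h.2.2 _).2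
  unfold pcoef; linarith

theorem fac_mem {n : ℕ} {z : ℕ → ℝ} (h : memE z) (j : ℕ) :
    0 ≤ muFactor n z j ∧ muFactor n z j ≤ 1 := by
  have hd := den_ge (n := n) h j
  have hp : 0 ≤ z (j+1) ^ n := pow_nonneg (h.2.2 _).1 _
  unfold muFactor
  split_ifs with hc
  · simp
  · exact ⟨div_nonneg hp (hp.trans hd), div_le_one_of_le₀ hd (hp.trans hd)⟩

theorem mu_mem {n : ℕ} {z : ℕ → ℝ} (h : memE z) (k : ℕ) :
    0 ≤ mu n z k ∧ mu n z k ≤ 1 := by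
  unfold mu
  exact ⟨Finset.prod_nonneg fun j _ => (fac_mem h j).1,
    Finset.prod_le_one (fun j _ => (fac_mem h j).1) fun j _ => (fac_mem h j).2⟩

theorem mu_succ (n : ℕ) (z : ℕ → ℝ) (k : ℕ) : mu n z (k+1) = mu n z k * muFactor n z k := by
  unfold mu; rw [Finset.prod_range_succ]

theorem pcoef_lip {n : ℕ} {z w : ℕ → ℝ} (hz : memE z) (hw : memE w) (j : ℕ) :
    |pcoef n z j - pcoef n w j| ≤
      n * (|z j - w j| + |z (j+1) - w (j+1)|) + n * (n * |z (j+1) - w (j+1)|) := by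
  unfold pcoef
  have e : (n:ℝ) * (z j - z (j + 1)) * z (j + 1) ^ (n - 1) - n * (w j - w (j + 1)) * w (j + 1) ^ (n - 1)
    = n * (((z j - w j) - (z (j+1) - w (j+1))) * z (j+1)^(n-1)) +
      n * ((w j - w (j+1)) * (z (j+1)^(n-1) - w (j+1)^(n-1))) := by ring
  rw [e]
  refine (abs_add_le _ _).trans ?_
  have hz1 := hz.2.2 (j+1)
  have hw1 := hw.2.2 (j+1)
  have hw0 := hw.2.2 j
  have hm := hw.2.1 j
  have hp := aux_pow _ _ hz1.1 hz1.2 hw1.1 hw1.2 (n-1)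
  have hn : ((n-1 : ℕ):ℝ) ≤ n := by exact_mod_cast Nat.sub_le n 1
  have hn0 : (0:ℝ) ≤ n := Nat.cast_nonneg n
  rw [abs_mul, abs_mul, abs_mul, abs_mul, abs_of_nonneg hn0,
    abs_of_nonneg (pow_nonneg hz1.1 _), abs_of_nonneg (sub_nonneg.2 hm)]
  have h1 : |z j - w j - (z (j + 1) - w (j + 1))| * z (j + 1) ^ (n - 1) ≤
      |z j - w j| + |z (j+1) - w (j+1)| :=
    (mul_le_of_le_one_right (abs_nonneg _) (pow_le_one₀ hz1.1 hz1.2)).trans (abs_sub _ _)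
  have h2 : (w j - w (j+1)) * |z (j+1)^(n-1) - w (j+1)^(n-1)| ≤ n * |z (j+1) - w (j+1)| :=
    (mul_le_of_le_one_left (abs_nonneg _) (by linarith)).trans
      (hp.trans (mul_le_mul_of_nonneg_right hn (abs_nonneg _)))
  gcongr

theorem frac_aux {B B' d d' : ℝ} (hB : 0 ≤ B) (hB' : 0 ≤ B') (hd : B ≤ d) (hd' : B' ≤ d') :
    B * |(if B = 0 ∧ d = 0 then 1 else B / d) - (if B' = 0 ∧ d' = 0 then 1 else B' / d')| ≤
      |B - B'| + |d - d'| := by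
  rcases hB.eq_or_lt with h0 | h0
  · rw [← h0]; simp only [zero_mul]; positivity
  have hdp : 0 < d := h0.trans_le hd
  rw [if_neg (fun h => h0.ne' h.1)]
  by_cases hc : B' = 0 ∧ d' = 0
  · rw [if_pos hc, hc.1, hc.2]
    have e : B / d - 1 = -((d - B) / d) := by field_simp; ring
    rw [e, abs_neg, abs_of_nonneg (div_nonneg (by linarith) hdp.le), sub_zero, sub_zero,
      abs_of_pos h0, abs_of_pos hdp]
    have : B * ((d - B)/d) = (B/d) * (d-B) := by ring
    rw [this]
    have := mul_le_of_le_one_left (sub_nonneg.2 hd) (div_le_one_of_le₀ hd hdp.le)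
    linarith
  · rw [if_neg hc]
    have hdp' : 0 < d' := by
      rcases (hB'.trans hd').eq_or_lt with h | h
      · exact absurd ⟨le_antisymm (hd'.trans h.symm.le) hB', h.symm⟩ hc
      · exact h
    have e : B * (B / d - B' / d') = (B/d) * (B - B') + (B/d) * (B'/d') * (d' - d) := by
      field_simp; ring
    have hf := div_le_one_of_le₀ hd hdp.le
    have hf' := div_le_one_of_le₀ hd' hdp'.le
    have hf0 : 0 ≤ B/d := by positivity
    have hf0' : 0 ≤ B'/d' := by positivity
    rw [← abs_of_pos h0, ← abs_mul, abs_of_pos h0, e]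
    refine (abs_add_le _ _).trans ?_
    rw [abs_mul, abs_mul, abs_of_nonneg hf0, abs_of_nonneg (mul_nonneg hf0 hf0'), abs_sub_comm d' d]
    exact add_le_add (mul_le_of_le_one_left (abs_nonneg _) hf)
      (mul_le_of_le_one_left (abs_nonneg _) (mul_le_one₀ hf hf0' hf'))

theorem fac_lip {n : ℕ} {z w : ℕ → ℝ} (hz : memE z) (hw : memE w) (j : ℕ) :
    z (j+1) ^ n * |muFactor n z j - muFactor n w j| ≤
      (2 * n + n * n) * (|z j - w j| + |z (j+1) - w (j+1)|) := by
  have h := frac_aux (pow_nonneg (hz.2.2 (j+1)).1 n) (pow_nonneg (hw.2.2 (j+1)).1 n)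
    (den_ge hz j) (den_ge hw j)
  have hp := aux_pow _ _ (hz.2.2 (j+1)).1 (hz.2.2 (j+1)).2 (hw.2.2 (j+1)).1 (hw.2.2 (j+1)).2 n
  have hq := pcoef_lip (n := n) hz hw j
  have e : (1 - pcoef n z j) - (1 - pcoef n w j) = -(pcoef n z j - pcoef n w j) := by ring
  rw [e, abs_neg] at h
  unfold muFactor
  refine h.trans ((add_le_add hp hq).trans ?_)
  have hn0 : (0:ℝ) ≤ n := Nat.cast_nonneg n
  have := mul_nonneg hn0 (abs_nonneg (z j - w j))
  have := mul_nonneg (mul_nonneg hn0 hn0) (abs_nonneg (z j - w j))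
  nlinarith

/-- `g_k = z_k^n μ(z,k)`. -/
def gg (n : ℕ) (z : ℕ → ℝ) (k : ℕ) : ℝ := z k ^ n * mu n z k

theorem mu_lip {n : ℕ} {z w : ℕ → ℝ} (hz : memE z) (hw : memE w) (k : ℕ) (c : ℝ) (hc : 0 ≤ c) :
    (∀ j, j < k → c ≤ z (j+1) ^ n) → c * |mu n z k - mu n w k| ≤
      ∑ j ∈ Finset.range k, (2 * n + n * n) * (|z j - w j| + |z (j+1) - w (j+1)|) := by
  induction k with
  | zero => intro _; simp [mu]
  | succ k ih =>
    intro h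
    rw [mu_succ, mu_succ, Finset.sum_range_succ]
    have e : mu n z k * muFactor n z k - mu n w k * muFactor n w k
      = (mu n z k - mu n w k) * muFactor n w k + mu n z k * (muFactor n z k - muFactor n w k) := by
      ring
    rw [e]
    have h1 : |(mu n z k - mu n w k) * muFactor n w k| ≤ |mu n z k - mu n w k| := by
      rw [abs_mul, abs_of_nonneg (fac_mem hw k).1]
      exact mul_le_of_le_one_right (abs_nonneg _) (fac_mem hw k).2
    have h2 : |mu n z k * (muFactor n z k - muFactor n w k)| ≤ |muFactor n z k - muFactor n w k| := by
      rw [abs_mul, abs_of_nonneg (mu_mem hz k).1]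
      exact mul_le_of_le_one_left (abs_nonneg _) (mu_mem hz k).2
    have h3 := mul_le_mul_of_nonneg_left ((abs_add_le _ _).trans (add_le_add h1 h2)) hc
    refine h3.trans ?_
    rw [mul_add]
    refine add_le_add (ih fun j hj => h j (by omega)) ?_
    exact (mul_le_mul_of_nonneg_right (h k (by omega)) (abs_nonneg _)).trans (fac_lip hz hw k)

theorem gg_lip {n : ℕ} {z w : ℕ → ℝ} (hz : memE z) (hw : memE w) (k : ℕ) :
    |gg n z k - gg n w k| ≤
      3 * (2 * n + n * n) * ∑ i ∈ Finset.range (k+1), |z i - w i| := by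
  have hn0 : (0:ℝ) ≤ n := Nat.cast_nonneg n
  have h1 := mu_lip (n := n) hz hw k (z k ^ n) (pow_nonneg (hz.2.2 k).1 n) (fun j hj =>
    pow_le_pow_left₀ (hz.2.2 k).1 (memE_anti hz (by omega)) n)
  have hp := aux_pow _ _ (hz.2.2 k).1 (hz.2.2 k).2 (hw.2.2 k).1 (hw.2.2 k).2 n
  rw [← Finset.mul_sum, Finset.sum_add_distrib] at h1
  have e1 := Finset.sum_range_succ (fun i => |z i - w i|) k
  have e2 := Finset.sum_range_succ' (fun i => |z i - w i|) k
  have e : gg n z k - gg n w k =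
    (z k ^ n - w k ^ n) * mu n w k + z k ^ n * (mu n z k - mu n w k) := by unfold gg; ring
  have hS : |z k - w k| ≤ ∑ i ∈ Finset.range (k+1), |z i - w i| :=
    Finset.single_le_sum (f := fun i => |z i - w i|) (fun _ _ => abs_nonneg _)
      (Finset.mem_range.2 (Nat.lt_succ_self k))
  have a0 := abs_nonneg (z 0 - w 0)
  have ak := abs_nonneg (z k - w k)
  set S := ∑ i ∈ Finset.range (k+1), |z i - w i|
  rw [e]
  refine (abs_add_le _ _).trans ?_
  rw [abs_mul, abs_mul, abs_of_nonneg (mu_mem hw k).1, abs_of_nonneg (pow_nonneg (hz.2.2 k).1 n)]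
  have h3 : |z k ^ n - w k ^ n| * mu n w k ≤ n * S :=
    (mul_le_of_le_one_right (abs_nonneg _) (mu_mem hw k).2).trans
      (hp.trans (mul_le_mul_of_nonneg_left hS hn0))
  have h4 : (2 * (n:ℝ) + n * n) * (∑ i ∈ Finset.range k, |z i - w i| +
      ∑ i ∈ Finset.range k, |z (i+1) - w (i+1)|) ≤ (2 * (n:ℝ) + n * n) * (S + S) := by
    apply mul_le_mul_of_nonneg_left _ (by positivity)
    linarith
  have hS0 : 0 ≤ S := ak.trans hS
  have := mul_nonneg hn0 hS0
  have := mul_nonneg (mul_nonneg hn0 hn0) hS0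
  nlinarith

theorem vfield_succ (lam : ℝ) (n : ℕ) (z : ℕ → ℝ) (k : ℕ) :
    vfield lam n z (k+1) = lam * (gg n z k - gg n z (k+1)) - (z (k+1) - z (k+2)) := by
  unfold vfield gg
  simp only [Nat.add_sub_cancel]; ring

theorem gg_mem {n : ℕ} {z : ℕ → ℝ} (h : memE z) (k : ℕ) : 0 ≤ gg n z k ∧ gg n z k ≤ 1 := by
  unfold gg
  exact ⟨mul_nonneg (pow_nonneg (h.2.2 k).1 n) (mu_mem h k).1,
    mul_le_one₀ (pow_le_one₀ (h.2.2 k).1 (h.2.2 k).2) (mu_mem h k).1 (mu_mem h k).2⟩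

theorem gg_anti {n : ℕ} {z : ℕ → ℝ} (h : memE z) (k : ℕ) : gg n z (k+1) ≤ gg n z k := by
  unfold gg
  rw [mu_succ]
  have := mul_le_of_le_one_right (mu_mem (n := n) h k).1 (fac_mem (n := n) h k).2
  exact mul_le_mul (pow_le_pow_left₀ (h.2.2 _).1 (h.2.1 k) n) this
    (mul_nonneg (mu_mem h k).1 (fac_mem h k).1) (pow_nonneg (h.2.2 k).1 n)

/-- convexity of `g` at a flat spot -/
theorem gg_conv {n : ℕ} {z : ℕ → ℝ} (h : memE z) (k : ℕ) (hk : z (k+2) = z (k+1)) :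
    0 ≤ gg n z k - 2 * gg n z (k+1) + gg n z (k+2) := by
  have hf : muFactor n z (k+1) = z (k+1) ^ n := by
    unfold muFactor pcoef
    simp [hk, show k+1+1 = k+2 from rfl]
  have e : gg n z k - 2 * gg n z (k+1) + gg n z (k+2)
    = mu n z k * (z k ^ n - z (k+1)^n * (2 - z (k+1)^n) * muFactor n z k) := by
    unfold gg
    rw [show k + 2 = (k+1)+1 from rfl, mu_succ n z (k+1), mu_succ n z k, hf,
      show z (k+1+1) = z (k+1) from hk]
    ring
  rw [e]
  refine mul_nonneg (mu_mem h k).1 ?_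
  have hB := aux_bern (z k) (z (k+1)) (h.2.2 _).1 (h.2.1 k) n
  have hA1 : z k ^ n ≤ 1 := pow_le_one₀ (h.2.2 _).1 (h.2.2 _).2
  have hC0 : 0 ≤ z (k+1) ^ n := pow_nonneg (h.2.2 _).1 _
  have hCA : z (k+1) ^ n ≤ z k ^ n := pow_le_pow_left₀ (h.2.2 _).1 (h.2.1 k) n
  have hd := den_ge (n := n) h k
  unfold muFactor
  have hdef : pcoef n z k ≤ z k ^ n - z (k+1) ^ n := hB
  set A := z k ^ n
  set C := z (k+1) ^ n
  set p := pcoef n z k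
  split_ifs with hc
  · rw [hc.1]; simp; linarith
  · rcases hC0.eq_or_lt with h0 | h0
    · rw [← h0]; simp; linarith
    have hdp : 0 < 1 - p := h0.trans_le hd
    have hA0 : 0 ≤ A := hC0.trans hCA
    have h1 : C ≤ A * (1 - A + C) := by nlinarith
    have h2 : A * (1 - A + C) ≤ A * (1 - p) := mul_le_mul_of_nonneg_left (by linarith) hA0
    have h3 : C * (2 - C) * C ≤ C := by nlinarith [mul_nonneg hC0 (sq_nonneg (1 - C))]
    have : C * (2 - C) * (C / (1-p)) ≤ A := by
      rw [← mul_div_assoc, div_le_iff₀ hdp]; linarith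
    linarith

/-- Lipschitz constant of `g`. -/
def CC (n : ℕ) : ℝ := 3 * (2 * n + n * n)

theorem CC_nonneg (n : ℕ) : 0 ≤ CC n := by unfold CC; positivity

theorem update_memE {z : ℕ → ℝ} (h : memE z) (k : ℕ) (c : ℝ) (h1 : z (k+2) ≤ c) (h2 : c ≤ z k) :
    memE (Function.update z (k+1) c) := by
  refine ⟨?_, ?_, ?_⟩
  · rw [Function.update_of_ne (by omega)]; exact h.1
  · intro j
    by_cases h3 : j = k
    · subst h3; rw [Function.update_self, Function.update_of_ne (by omega)]; exact h2
    · by_cases h4 : j = k+1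
      · subst h4; rw [Function.update_self, Function.update_of_ne (by omega)]; exact h1
      · rw [Function.update_of_ne (by omega), Function.update_of_ne h4]; exact h.2.1 j
  · intro j
    by_cases h4 : j = k+1
    · subst h4; rw [Function.update_self]
      exact ⟨(h.2.2 _).1.trans h1, h2.trans (h.2.2 _).2⟩
    · rw [Function.update_of_ne h4]; exact h.2.2 j

theorem gg_update {n : ℕ} {z : ℕ → ℝ} (h : memE z) (k : ℕ) (c : ℝ)
    (h1 : z (k+2) ≤ c) (h2 : c ≤ z k) (j : ℕ) :
    |gg n z j - gg n (Function.update z (k+1) c) j| ≤ CC n * |z (k+1) - c| := by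
  refine (gg_lip h (update_memE h k c h1 h2) j).trans ?_
  refine mul_le_mul_of_nonneg_left ?_ (CC_nonneg n)
  have : ∀ i ∈ Finset.range (j+1), |z i - Function.update z (k+1) c i| =
      if i = k+1 then |z (k+1) - c| else 0 := by
    intro i _
    split_ifs with hi
    · subst hi; rw [Function.update_self]
    · rw [Function.update_of_ne hi]; simp
  rw [Finset.sum_congr rfl this, Finset.sum_ite_eq']
  split_ifs
  · exact le_rfl
  · exact abs_nonneg _

theorem v_mono {lam : ℝ} (hlam0 : 0 < lam) (hlam1 : lam < 1) {n : ℕ} {z : ℕ → ℝ} (h : memE z)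
    (k : ℕ) : -(4 * CC n + 1) * (z (k+1) - z (k+2)) ≤ vfield lam n z (k+1) - vfield lam n z (k+2) := by
  rw [vfield_succ, show k+2 = (k+1)+1 from rfl, vfield_succ]
  have hm := h.2.1 (k+1)
  have hm0 := h.2.1 k
  have hm2 := h.2.1 (k+2)
  have hu := gg_update (n := n) h k (z (k+2)) le_rfl (hm.trans hm0)
  have hc := gg_conv (n := n) (update_memE h k (z (k+2)) le_rfl (hm.trans hm0)) k (by
    rw [Function.update_self, Function.update_of_ne (by omega)])
  have e : |z (k+1) - z (k+2)| = z (k+1) - z (k+2) := abs_of_nonneg (sub_nonneg.2 hm)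
  have u0 := abs_le.1 (hu k)
  have u1 := abs_le.1 (hu (k+1))
  have u2 := abs_le.1 (hu (k+2))
  rw [e] at u0 u1 u2
  have hX : 0 ≤ CC n * (z (k+1) - z (k+2)) := mul_nonneg (CC_nonneg n) (sub_nonneg.2 hm)
  simp only [show k+1+1 = k+2 from rfl, show k+1+2 = k+3 from rfl, show k+2+1=k+3 from rfl] at *
  have hG : -(4 * (CC n * (z (k+1) - z (k+2)))) ≤ gg n z k - 2 * gg n z (k+1) + gg n z (k+2) := by
    linarith [u0.1, u1.2, u2.1]
  have hL : -(4 * (CC n * (z (k+1) - z (k+2)))) ≤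
      lam * (gg n z k - 2 * gg n z (k+1) + gg n z (k+2)) := by
    nlinarith
  nlinarith

theorem v_one {lam : ℝ} (hlam0 : 0 < lam) (hlam1 : lam < 1) {n : ℕ} {z : ℕ → ℝ} (h : memE z) :
    vfield lam n z 1 ≤ CC n * (1 - z 1) := by
  rw [show 1 = 0 + 1 from rfl, vfield_succ]
  have h1 : z 1 ≤ 1 := (h.2.2 1).2
  have hu := gg_update (n := n) h 0 1 (h.2.2 2).2 h.1.ge 1
  have e1 : gg n (Function.update z (0+1) 1) 1 = 1 := by
    unfold gg mu muFactor pcoef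
    simp [h.1]
  have e0 : gg n z 0 = 1 := by unfold gg mu; simp [h.1]
  simp only [zero_add] at *
  rw [e1, abs_sub_comm (z 1) 1, abs_of_nonneg (sub_nonneg.2 h1)] at hu
  have h3 := (abs_le.1 hu).1
  have h4 : gg n z 1 ≤ 1 := (gg_mem h 1).2
  rw [e0]
  have := h.2.1 1
  simp only [show 1 + 1 = 2 from rfl] at *
  nlinarith

theorem v_ge {lam : ℝ} (hlam0 : 0 < lam) {n : ℕ} {z : ℕ → ℝ} (h : memE z) (k : ℕ) :
    - z (k+1) ≤ vfield lam n z (k+1) := by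
  rw [vfield_succ]
  have := mul_nonneg hlam0.le (sub_nonneg.2 (gg_anti (n := n) h k))
  linarith [(h.2.2 (k+2)).1]

theorem sum_two_pow (k : ℕ) (δ : ℝ) (hδ : 0 ≤ δ) :
    ∑ i ∈ Finset.range (k+1), 2 ^ i * δ ≤ 2 * (2 ^ k * δ) := by
  induction k with
  | zero => simp; linarith
  | succ k ih =>
    rw [Finset.sum_range_succ]
    have : (2:ℝ)^(k+1) = 2 * 2^k := by ring
    rw [this]; linarith

/-- Weighted Lipschitz constant of `v`. -/
def KK (n : ℕ) : ℝ := 4 * CC n + 3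

theorem KK_pos (n : ℕ) : 0 < KK n := by unfold KK; linarith [CC_nonneg n]

theorem v_lip {lam : ℝ} (hlam0 : 0 < lam) (hlam1 : lam < 1) {n : ℕ} {z w : ℕ → ℝ}
    (hz : memE z) (hw : memE w) (δ : ℝ) (hδ : 0 ≤ δ) (h : ∀ i, |z i - w i| ≤ 2 ^ i * δ) (k : ℕ) :
    |vfield lam n z (k+1) - vfield lam n w (k+1)| ≤ KK n * (2 ^ (k+1) * δ) := by
  have hg : ∀ j, |gg n z j - gg n w j| ≤ CC n * (2 * (2 ^ j * δ)) := fun j =>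
    (gg_lip hz hw j).trans (mul_le_mul_of_nonneg_left
      ((Finset.sum_le_sum fun i _ => h i).trans (sum_two_pow j δ hδ)) (CC_nonneg n))
  rw [vfield_succ, vfield_succ]
  have g0 := hg k
  have g1 := hg (k+1)
  have d1 := h (k+1)
  have d2 := h (k+2)
  have e1 : (2:ℝ)^(k+1) = 2 * 2^k := by ring
  have e2 : (2:ℝ)^(k+2) = 4 * 2^k := by ring
  rw [e1] at g1 d1
  rw [e2] at d2
  rw [e1]
  unfold KK
  have hX : 0 ≤ 2 ^ k * δ := by positivity
  have hCX := mul_nonneg (CC_nonneg n) hX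
  have hG : |(gg n z k - gg n z (k+1)) - (gg n w k - gg n w (k+1))| ≤ 6 * (CC n * (2^k * δ)) := by
    rw [abs_le] at *
    constructor <;> nlinarith
  have hL : |lam * ((gg n z k - gg n z (k+1)) - (gg n w k - gg n w (k+1)))| ≤ 6 * (CC n * (2^k * δ)) := by
    rw [abs_mul, abs_of_pos hlam0]
    exact (mul_le_of_le_one_left (abs_nonneg _) hlam1.le).trans hG
  rw [abs_le] at *
  constructor <;> nlinarith

/-- Running-minimum retraction onto `E`. -/
def rr (y : ℕ → ℝ) : ℕ → ℝ
  | 0 => 1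
  | k+1 => min (rr y k) (max 0 (y (k+1)))

theorem rr_memE (y : ℕ → ℝ) : memE (rr y) := by
  have h2 : ∀ k, rr y (k+1) ≤ rr y k := fun k => min_le_left _ _
  refine ⟨rfl, h2, fun k => ?_⟩
  induction k with
  | zero => simp [rr]
  | succ k ih => exact ⟨le_min ih.1 (le_max_left _ _), (h2 k).trans ih.2⟩

theorem rr_eq {y : ℕ → ℝ} (h : memE y) : rr y = y := by
  funext k
  induction k with
  | zero => exact h.1.symm
  | succ k ih =>
    simp only [rr]
    rw [ih, max_eq_right (h.2.2 _).1, min_eq_right (h.2.1 k)]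

theorem rr_lip {y w : ℕ → ℝ} {δ : ℝ} (hδ : 0 ≤ δ) (h : ∀ i, |y i - w i| ≤ 2 ^ i * δ) (i : ℕ) :
    |rr y i - rr w i| ≤ 2 ^ i * δ := by
  induction i with
  | zero => simp [rr, hδ]
  | succ k ih =>
    simp only [rr]
    refine (abs_min_sub_min_le_max _ _ _ _).trans (max_le ?_ ?_)
    · refine ih.trans ?_
      have : (0:ℝ) ≤ 2 ^ k * δ := by positivity
      rw [pow_succ]; linarith
    · refine (abs_max_sub_max_le_max _ _ _ _).trans (max_le ?_ (h _))
      simp; positivity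

/-- The Euler step map, which preserves `E`. -/
def FF (lam : ℝ) (n : ℕ) (z : ℕ → ℝ) : ℕ → ℝ
  | 0 => 1
  | k+1 => z (k+1) + (KK n)⁻¹ * vfield lam n z (k+1)

theorem FF_memE {lam : ℝ} (hlam0 : 0 < lam) (hlam1 : lam < 1) (n : ℕ) {z : ℕ → ℝ} (h : memE z) :
    memE (FF lam n z) := by
  have hK := KK_pos n
  have hC := CC_nonneg n
  have hKi : 0 < (KK n)⁻¹ := inv_pos.2 hK
  have hKd : KK n = 4 * CC n + 3 := rfl
  have key : ∀ d v : ℝ, 0 ≤ d → -(KK n * d) ≤ v → 0 ≤ d + (KK n)⁻¹ * v := by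
    intro d v _ hv
    have := mul_le_mul_of_nonneg_left hv hKi.le
    have e : (KK n)⁻¹ * -(KK n * d) = -d := by field_simp
    linarith
  have h2 : ∀ k, FF lam n z (k+1) ≤ FF lam n z k := by
    intro k
    cases k with
    | zero =>
      simp only [FF]
      have h1 := v_one hlam0 hlam1 (n := n) h
      have hd : 0 ≤ 1 - z 1 := sub_nonneg.2 (h.2.2 1).2
      have := key (1 - z 1) (-vfield lam n z 1) hd (by nlinarith)
      simp only [zero_add]; linarith
    | succ k =>
      simp only [FF]
      have h1 := v_mono hlam0 hlam1 (n := n) h k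
      have hd : 0 ≤ z (k+1) - z (k+2) := sub_nonneg.2 (h.2.1 _)
      have := key _ _ hd ((by nlinarith : -(KK n * (z (k+1) - z (k+2))) ≤ _).trans h1)
      simp only [show k+1+1 = k+2 from rfl]; linarith
  have h0 : ∀ k, 0 ≤ FF lam n z k := by
    intro k
    cases k with
    | zero => simp [FF]
    | succ k =>
      simp only [FF]
      have hz := (h.2.2 (k+1)).1
      exact key _ _ hz ((by nlinarith : _ ≤ - z (k+1)).trans (v_ge hlam0 h k))
  exact ⟨rfl, h2, fun k => ⟨h0 k, (antitone_nat_of_succ_le h2 (Nat.zero_le k)).trans le_rfl⟩⟩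

theorem FF_lip {lam : ℝ} (hlam0 : 0 < lam) (hlam1 : lam < 1) (n : ℕ) {z w : ℕ → ℝ}
    (hz : memE z) (hw : memE w) (δ : ℝ) (hδ : 0 ≤ δ) (h : ∀ i, |z i - w i| ≤ 2 ^ i * δ) (k : ℕ) :
    |FF lam n z k - FF lam n w k| ≤ 2 * δ * 2 ^ k := by
  have hK := KK_pos n
  cases k with
  | zero => simp [FF, hδ]
  | succ k =>
    simp only [FF]
    have h1 := v_lip hlam0 hlam1 (n := n) hz hw δ hδ h k
    have h2 := h (k+1)
    have e : z (k+1) + (KK n)⁻¹ * vfield lam n z (k+1) - (w (k+1) + (KK n)⁻¹ * vfield lam n w (k+1))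
      = (z (k+1) - w (k+1)) + (KK n)⁻¹ * (vfield lam n z (k+1) - vfield lam n w (k+1)) := by ring
    rw [e]
    refine (abs_add_le _ _).trans ?_
    rw [abs_mul, abs_of_pos (inv_pos.2 hK)]
    have h3 := mul_le_mul_of_nonneg_left h1 (inv_pos.2 hK).le
    rw [inv_mul_cancel_left₀ hK.ne'] at h3
    linarith

open BoundedContinuousFunction in
/-- The Euler map on the weighted Banach space. -/
def PP {lam : ℝ} (hlam0 : 0 < lam) (hlam1 : lam < 1) (n : ℕ)
    (Y : BoundedContinuousFunction ℕ ℝ) : BoundedContinuousFunction ℕ ℝ :=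
  ofNormedAddCommGroupDiscrete (fun k => FF lam n (rr fun i => 2 ^ i * Y i) k / 2 ^ k) 1 (by
    intro k
    have h := (FF_memE hlam0 hlam1 n (rr_memE fun i => 2 ^ i * Y i)).2.2 k
    rw [Real.norm_eq_abs, abs_of_nonneg (div_nonneg h.1 (by positivity))]
    exact div_le_one_of_le₀ (h.2.trans (one_le_pow₀ (by norm_num))) (by positivity))

theorem PP_apply {lam : ℝ} (hlam0 : 0 < lam) (hlam1 : lam < 1) (n : ℕ)
    (Y : BoundedContinuousFunction ℕ ℝ) (k : ℕ) :
    PP hlam0 hlam1 n Y k = FF lam n (rr fun i => 2 ^ i * Y i) k / 2 ^ k := rfl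

theorem PP_norm {lam : ℝ} (hlam0 : 0 < lam) (hlam1 : lam < 1) (n : ℕ)
    (Y : BoundedContinuousFunction ℕ ℝ) : ‖PP hlam0 hlam1 n Y‖ ≤ 1 := by
  refine (BoundedContinuousFunction.norm_le zero_le_one).2 fun k => ?_
  have h := (FF_memE hlam0 hlam1 n (rr_memE fun i => 2 ^ i * Y i)).2.2 k
  rw [PP_apply, Real.norm_eq_abs, abs_of_nonneg (div_nonneg h.1 (by positivity))]
  exact div_le_one_of_le₀ (h.2.trans (one_le_pow₀ (by norm_num))) (by positivity)

theorem PP_lip {lam : ℝ} (hlam0 : 0 < lam) (hlam1 : lam < 1) (n : ℕ)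
    (Y W : BoundedContinuousFunction ℕ ℝ) :
    dist (PP hlam0 hlam1 n Y) (PP hlam0 hlam1 n W) ≤ 2 * dist Y W := by
  refine (BoundedContinuousFunction.dist_le (by positivity)).2 fun k => ?_
  rw [PP_apply, PP_apply, Real.dist_eq, ← sub_div, abs_div,
    abs_of_pos (show (0:ℝ) < 2 ^ k by positivity), div_le_iff₀ (by positivity)]
  refine FF_lip hlam0 hlam1 n (rr_memE _) (rr_memE _) (dist Y W) dist_nonneg ?_ k
  refine rr_lip dist_nonneg fun i => ?_
  rw [← mul_sub, abs_mul, abs_of_pos (show (0:ℝ) < 2 ^ i by positivity)]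
  refine mul_le_mul_of_nonneg_left ?_ (by positivity)
  rw [← Real.dist_eq]
  exact BoundedContinuousFunction.dist_coe_le_dist i

theorem PP_cont {lam : ℝ} (hlam0 : 0 < lam) (hlam1 : lam < 1) (n : ℕ) :
    Continuous (PP hlam0 hlam1 n) :=
  (LipschitzWith.of_dist_le_mul (K := 2) (PP_lip hlam0 hlam1 n)).continuous

theorem bcf_dist_smul {c : ℝ} (hc : 0 ≤ c) (X W : BoundedContinuousFunction ℕ ℝ) :
    dist (c • X) (c • W) ≤ c * dist X W := by
  refine (BoundedContinuousFunction.dist_le (by positivity)).2 fun k => ?_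
  change dist (c * X k) (c * W k) ≤ _
  rw [Real.dist_eq, ← mul_sub, abs_mul, abs_of_nonneg hc, ← Real.dist_eq]
  exact mul_le_mul_of_nonneg_left (BoundedContinuousFunction.dist_coe_le_dist k) hc

theorem nonneg_of_deriv {f f' : ℝ → ℝ} {T : ℝ}
    (h : ∀ t ∈ Set.Icc 0 T, HasDerivWithinAt f (f' t) (Set.Icc 0 T) t)
    (h' : ∀ t ∈ Set.Icc 0 T, 0 ≤ f' t) (h0 : 0 ≤ f 0) : ∀ t ∈ Set.Icc 0 T, 0 ≤ f t := by
  intro t ht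
  have hm : MonotoneOn f (Set.Icc 0 T) :=
    monotoneOn_of_hasDerivWithinAt_nonneg (f' := f') (convex_Icc 0 T)
      (fun s hs => (h s hs).continuousWithinAt)
      (fun s hs => (h s (interior_subset hs)).mono interior_subset)
      (fun s hs => h' s (interior_subset hs))
  exact h0.trans (hm ⟨le_rfl, ht.1.trans ht.2⟩ ht ht.1)

/-- Solutions on `[0,T]`. -/
def SolOn (lam : ℝ) (n : ℕ) (T : ℝ) (z : ℕ → ℝ → ℝ) : Prop :=
  (∀ t ∈ Set.Icc 0 T, memE (fun k => z k t)) ∧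
  ∀ k, ∀ t ∈ Set.Icc 0 T,
    HasDerivWithinAt (z (k+1)) (vfield lam n (fun j => z j t) (k+1)) (Set.Icc 0 T) t

theorem SolOn.mono {lam : ℝ} {n : ℕ} {T S : ℝ} {z : ℕ → ℝ → ℝ} (h : SolOn lam n T z) (hS : S ≤ T) :
    SolOn lam n S z :=
  ⟨fun t ht => h.1 t ⟨ht.1, ht.2.trans hS⟩, fun k t ht =>
    (h.2 k t ⟨ht.1, ht.2.trans hS⟩).mono (Set.Icc_subset_Icc_right hS)⟩

theorem sol_unique {lam : ℝ} (hlam0 : 0 < lam) (hlam1 : lam < 1) {n : ℕ} {T : ℝ}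
    {z w : ℕ → ℝ → ℝ} (hz : SolOn lam n T z) (hw : SolOn lam n T w) (h0 : ∀ k, z k 0 = w k 0) :
    ∀ t ∈ Set.Icc 0 T, ∀ k, z k t = w k t := by
  have hK := KK_pos n
  have key : ∀ m : ℕ, ∀ t ∈ Set.Icc 0 T, ∀ k,
      |z k t - w k t| ≤ 2 ^ k * ((KK n * t) ^ m / (m.factorial : ℝ)) := by
    intro m
    induction m with
    | zero =>
      intro t ht k
      have a := (hz.1 t ht).2.2 k
      have b := (hw.1 t ht).2.2 k
      have : (1:ℝ) ≤ 2 ^ k := one_le_pow₀ (by norm_num)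
      simp only [pow_zero, Nat.factorial_zero, Nat.cast_one, div_one, mul_one]
      rw [abs_le]; constructor <;> linarith [a.1, a.2, b.1, b.2]
    | succ m ih =>
      intro t ht k
      cases k with
      | zero =>
        have a := (hz.1 t ht).1
        have b := (hw.1 t ht).1
        simp only at a b
        rw [a, b]; simp
        have := ht.1
        positivity
      | succ k =>
        have hd : ∀ s ∈ Set.Icc 0 T, HasDerivWithinAt (fun s => z (k+1) s - w (k+1) s)
            (vfield lam n (fun j => z j s) (k+1) - vfield lam n (fun j => w j s) (k+1))
            (Set.Icc 0 T) s := fun s hs => (hz.2 k s hs).sub (hw.2 k s hs)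
        refine image_norm_le_of_norm_deriv_right_le_deriv_boundary
          (f := fun s => z (k+1) s - w (k+1) s) (a := 0) (b := T)
          (B := fun s => 2 ^ (k+1) * ((KK n * s) ^ (m+1) / ((m+1).factorial : ℝ)))
          (B' := fun s => KK n * (2 ^ (k+1) * ((KK n * s) ^ m / (m.factorial : ℝ))))
          (fun s hs => (hd s hs).continuousWithinAt)
          (fun s hs => (hd s (Set.Ico_subset_Icc_self hs)).mono_of_mem_nhdsWithin
            (Icc_mem_nhdsGE_of_mem hs)) ?_ ?_ ?_ ht
        · simp [h0]
        · intro s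
          have h1 : HasDerivAt (fun s : ℝ => (KK n * s) ^ (m+1))
              (((m+1 : ℕ):ℝ) * (KK n * s) ^ m * (KK n * 1)) s :=
            ((hasDerivAt_id s).const_mul (KK n)).pow (m+1)
          refine ((h1.div_const ((m+1).factorial : ℝ)).const_mul ((2:ℝ) ^ (k+1))).congr_deriv ?_
          rw [Nat.factorial_succ]
          push_cast
          have : (m.factorial : ℝ) ≠ 0 := by positivity
          field_simp
        · intro s hs
          have hs' := Set.Ico_subset_Icc_self hs
          have hs0 := hs.1
          exact v_lip hlam0 hlam1 (hz.1 s hs') (hw.1 s hs') _ (by positivity) (ih s hs') k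
  intro t ht k
  have hlim : Filter.Tendsto (fun m : ℕ => 2 ^ k * ((KK n * t) ^ m / (m.factorial : ℝ)))
      Filter.atTop (nhds 0) := by
    have := (FloorSemiring.tendsto_pow_div_factorial_atTop (KK n * t)).const_mul ((2:ℝ) ^ k)
    simpa using this
  have := ge_of_tendsto' hlim fun m => key m t ht k
  exact sub_eq_zero.1 (abs_eq_zero.1 (le_antisymm this (abs_nonneg _)))

theorem sol_exists {lam : ℝ} (hlam0 : 0 < lam) (hlam1 : lam < 1) (n : ℕ) (T : ℝ) (hT : 0 ≤ T)
    (z0 : ℕ → ℝ) (hz0 : memE z0) : ∃ z : ℕ → ℝ → ℝ, SolOn lam n T z ∧ ∀ k, z k 0 = z0 k := by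
  have hK := KK_pos n
  set κ := KK n with hκ
  let Y0 : BoundedContinuousFunction ℕ ℝ :=
    BoundedContinuousFunction.ofNormedAddCommGroupDiscrete (fun k => z0 k / 2 ^ k) 1 (by
      intro k
      have h := hz0.2.2 k
      rw [Real.norm_eq_abs, abs_of_nonneg (div_nonneg h.1 (by positivity))]
      exact div_le_one_of_le₀ (h.2.trans (one_le_pow₀ (by norm_num))) (by positivity))
  have hY0 : ∀ k, Y0 k = z0 k / 2 ^ k := fun k => rfl
  let f : ℝ → BoundedContinuousFunction ℕ ℝ → BoundedContinuousFunction ℕ ℝ := fun t X =>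
    (κ * Real.exp (κ * t)) • PP hlam0 hlam1 n (Real.exp (-(κ * t)) • X)
  let L : NNReal := ⟨κ * Real.exp (κ * T), by positivity⟩
  let T' : NNReal := ⟨T, hT⟩
  have hPL : IsPicardLindelof f (⟨0, le_rfl, hT⟩ : Set.Icc 0 T) Y0 (L * T') 0 L
      ⟨2 * κ, by positivity⟩ := by
    refine ⟨?_, ?_, ?_, ?_⟩
    · intro t ht
      refine LipschitzOnWith.of_dist_le_mul fun X _ W _ => ?_
      have h1 := PP_lip hlam0 hlam1 n (Real.exp (-(κ * t)) • X) (Real.exp (-(κ * t)) • W)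
      replace h1 := h1.trans (mul_le_mul_of_nonneg_left
        (bcf_dist_smul (Real.exp_pos (-(κ * t))).le X W) zero_le_two)
      simp only [f]
      refine (bcf_dist_smul (by positivity) _ _).trans ?_
      refine (mul_le_mul_of_nonneg_left h1 (by positivity)).trans (le_of_eq ?_)
      have e : Real.exp (κ * t) * Real.exp (-(κ * t)) = 1 := by
        rw [← Real.exp_add]; simp
      change _ = 2 * κ * dist X W
      linear_combination (2 * κ * dist X W) * e
    · intro X _
      apply Continuous.continuousOn
      have := PP_cont hlam0 hlam1 n
      fun_prop
    · intro t ht X _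
      simp only [f]
      rw [norm_smul, Real.norm_eq_abs, abs_of_pos (by positivity)]
      refine (mul_le_of_le_one_right (by positivity) (PP_norm hlam0 hlam1 n _)).trans ?_
      change _ ≤ κ * Real.exp (κ * T)
      have := ht.2
      gcongr
    · simp [T', hT]
      exact le_of_eq rfl
  obtain ⟨X, hX0, hX⟩ := hPL.exists_eq_forall_mem_Icc_hasDerivWithinAt₀
  let x : ℕ → ℝ → ℝ := fun k t => 2 ^ k * X t k
  let y : ℕ → ℝ → ℝ := fun k t => Real.exp (-(κ * t)) * x k t
  have hx : ∀ k, ∀ t ∈ Set.Icc 0 T, HasDerivWithinAt (x k)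
      (κ * Real.exp (κ * t) * FF lam n (rr fun i => y i t) k) (Set.Icc 0 T) t := by
    intro k t ht
    have h1 := ((BoundedContinuousFunction.evalCLM ℝ k :
      BoundedContinuousFunction ℕ ℝ →L[ℝ] ℝ).hasFDerivAt.comp_hasDerivWithinAt t (hX t ht)).const_mul
        ((2:ℝ) ^ k)
    refine h1.congr_deriv ?_
    have e : (fun i => 2 ^ i * (Real.exp (-(κ * t)) • X t) i) = fun i => y i t := by
      funext i
      simp only [y, x, BoundedContinuousFunction.coe_smul, smul_eq_mul]; ring
    change 2 ^ k * ((κ * Real.exp (κ * t)) •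
      PP hlam0 hlam1 n (Real.exp (-(κ * t)) • X t) k) = _
    rw [PP_apply, e, smul_eq_mul]
    field_simp
  have hx0 : ∀ k, x k 0 = z0 k := by
    intro k
    simp only [x]
    have : X 0 = Y0 := hX0
    rw [this, hY0]; field_simp
  have hF : ∀ t, memE (FF lam n (rr fun i => y i t)) := fun t => FF_memE hlam0 hlam1 n (rr_memE _)
  have hee : ∀ t, Real.exp (-(κ * t)) * Real.exp (κ * t) = 1 := fun t => by
    rw [← Real.exp_add]; simp
  have hexp : ∀ t, HasDerivAt (fun t => Real.exp (κ * t)) (Real.exp (κ * t) * (κ * 1)) t :=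
    fun t => ((hasDerivAt_id t).const_mul κ).exp
  have hexpn : ∀ t, HasDerivAt (fun t => Real.exp (-(κ * t)))
      (Real.exp (-(κ * t)) * (-(κ * 1))) t :=
    fun t => (((hasDerivAt_id t).const_mul κ).neg).exp
  have hy : ∀ t ∈ Set.Icc 0 T, memE (fun k => y k t) := by
    intro t ht
    have a1 : 0 ≤ x 0 t - Real.exp (κ * t) := by
      refine nonneg_of_deriv (f := fun t => x 0 t - Real.exp (κ * t))
        (fun s hs => (hx 0 s hs).sub (hexp s).hasDerivWithinAt) ?_ ?_ t ht
      · intro s hs; rw [(hF s).1]; linarith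
      · simp [hx0, hz0.1]
    have a2 : 0 ≤ Real.exp (κ * t) - x 0 t := by
      refine nonneg_of_deriv (f := fun t => Real.exp (κ * t) - x 0 t)
        (fun s hs => (hexp s).hasDerivWithinAt.sub (hx 0 s hs)) ?_ ?_ t ht
      · intro s hs; rw [(hF s).1]; linarith
      · simp [hx0, hz0.1]
    have a3 : ∀ k, 0 ≤ x k t := by
      intro k
      refine nonneg_of_deriv (hx k) ?_ ?_ t ht
      · intro s hs; have := ((hF s).2.2 k).1; positivity
      · rw [hx0]; exact (hz0.2.2 k).1
    have a4 : ∀ k, 0 ≤ x k t - x (k+1) t := by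
      intro k
      refine nonneg_of_deriv (f := fun t => x k t - x (k+1) t)
        (fun s hs => (hx k s hs).sub (hx (k+1) s hs)) ?_ ?_ t ht
      · intro s hs
        rw [← mul_sub]
        have := sub_nonneg.2 ((hF s).2.1 k); positivity
      · simp only [hx0]; exact sub_nonneg.2 (hz0.2.1 k)
    have b1 : y 0 t = 1 := by
      have : x 0 t = Real.exp (κ * t) := by linarith
      simp only [y, this, hee]
    have b2 : ∀ k, y (k+1) t ≤ y k t := fun k =>
      mul_le_mul_of_nonneg_left (sub_nonneg.1 (a4 k)) (Real.exp_pos _).le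
    refine ⟨b1, b2, fun k => ⟨mul_nonneg (Real.exp_pos _).le (a3 k), ?_⟩⟩
    exact (antitone_nat_of_succ_le (f := fun k => y k t) b2 (Nat.zero_le k)).trans b1.le
  refine ⟨y, ⟨hy, ?_⟩, fun k => by simp [y, hx0]⟩
  intro k t ht
  refine ((hexpn t).hasDerivWithinAt.mul (hx (k+1) t ht)).congr_deriv ?_
  rw [rr_eq (hy t ht)]
  simp only [FF]
  have e1 : x (k+1) t * Real.exp (-(κ * t)) = y (k+1) t := by simp only [y]; ring
  have e2 : κ * (KK n)⁻¹ = 1 := mul_inv_cancel₀ hK.ne'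
  linear_combination (-κ) * e1 + κ * (y (k+1) t + (KK n)⁻¹ * vfield lam n (fun j => y j t) (k+1)) * hee t
    + vfield lam n (fun j => y j t) (k+1) * e2

theorem sol_global {lam : ℝ} (hlam0 : 0 < lam) (hlam1 : lam < 1) (n : ℕ)
    (z0 : ℕ → ℝ) (hz0 : memE z0) : ∃ z : ℕ → ℝ → ℝ, (∀ t, 0 ≤ t → memE (fun k => z k t)) ∧
      (∀ k t, 0 ≤ t → HasDerivWithinAt (z (k+1)) (vfield lam n (fun j => z j t) (k+1))
        (Set.Ici 0) t) ∧ ∀ k, z k 0 = z0 k := by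
  choose Z hZ hZ0 using fun N : ℕ =>
    sol_exists hlam0 hlam1 n ((N:ℝ)+1) (by positivity) z0 hz0
  have hag : ∀ N M : ℕ, N ≤ M → ∀ t ∈ Set.Icc (0:ℝ) (N+1), ∀ k, Z N k t = Z M k t := by
    intro N M hNM t ht k
    have hc : (N:ℝ) + 1 ≤ M + 1 := by
      have : (N:ℝ) ≤ M := by exact_mod_cast hNM
      linarith
    exact sol_unique hlam0 hlam1 (hZ N) ((hZ M).mono hc) (fun k => by rw [hZ0, hZ0]) t ht k
  let z : ℕ → ℝ → ℝ := fun k t => Z ⌊t⌋₊ k t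
  have hz : ∀ M : ℕ, ∀ t : ℝ, 0 ≤ t → t < M + 1 → ∀ k, z k t = Z M k t := by
    intro M t h0 h1 k
    refine hag _ _ ?_ t ⟨h0, (Nat.lt_floor_add_one t).le⟩ k
    have : ⌊t⌋₊ < M + 1 := (Nat.floor_lt h0).2 (by exact_mod_cast h1)
    omega
  refine ⟨z, ?_, ?_, ?_⟩
  · intro t ht
    exact (hZ ⌊t⌋₊).1 t ⟨ht, (Nat.lt_floor_add_one t).le⟩
  · intro k t ht
    have hlt := Nat.lt_floor_add_one t
    set M := ⌊t⌋₊
    have h1 := (hZ M).2 k t ⟨ht, hlt.le⟩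
    have h2 : HasDerivWithinAt (Z M (k+1)) (vfield lam n (fun j => Z M j t) (k+1)) (Set.Ici 0) t := by
      refine h1.mono_of_mem_nhdsWithin ?_
      rw [← Set.Ici_inter_Iic]
      exact Filter.inter_mem self_mem_nhdsWithin (mem_nhdsWithin_of_mem_nhds (Iic_mem_nhds hlt))
    refine h2.congr_of_eventuallyEq ?_ (hz M t ht hlt _)
    filter_upwards [self_mem_nhdsWithin, mem_nhdsWithin_of_mem_nhds (Iio_mem_nhds hlt)] with s hs hs'
    exact hz M s hs hs' _
  · intro k
    rw [hz 0 0 le_rfl (by simp) k, hZ0]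

theorem sol_summable {lam : ℝ} (hlam0 : 0 < lam) (hlam1 : lam < 1) {n : ℕ}
    {z : ℕ → ℝ → ℝ} (hE : ∀ t, 0 ≤ t → memE (fun k => z k t))
    (hd : ∀ k t, 0 ≤ t → HasDerivWithinAt (z (k+1)) (vfield lam n (fun j => z j t) (k+1))
        (Set.Ici 0) t) (hs : Summable fun k => z (k+1) 0) (t : ℝ) (ht : 0 ≤ t) :
    Summable fun k => z (k+1) t := by
  refine summable_of_sum_range_le (c := (∑' k, z (k+1) 0) + lam * t)
    (fun k => ((hE t ht).2.2 (k+1)).1) fun K => ?_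
  have htel : ∀ s, ∑ k ∈ Finset.range K, vfield lam n (fun j => z j s) (k+1) =
      lam * (gg n (fun j => z j s) 0 - gg n (fun j => z j s) K) - (z 1 s - z (K+1) s) := by
    intro s
    simp only [vfield_succ]
    rw [Finset.sum_sub_distrib, ← Finset.mul_sum, Finset.sum_range_sub' (gg n fun j => z j s),
      Finset.sum_range_sub' (fun k => z (k+1) s)]
  have hder : ∀ s ∈ Set.Icc 0 t, HasDerivWithinAt
      (fun s => (∑' k, z (k+1) 0) + lam * s - ∑ k ∈ Finset.range K, z (k+1) s)
      (lam * 1 - ∑ k ∈ Finset.range K, vfield lam n (fun j => z j s) (k+1)) (Set.Icc 0 t) s := by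
    intro s hs
    have h1 : HasDerivWithinAt (fun s => ∑ k ∈ Finset.range K, z (k+1) s)
        (∑ k ∈ Finset.range K, vfield lam n (fun j => z j s) (k+1)) (Set.Icc 0 t) s :=
      HasDerivWithinAt.fun_sum fun k _ => (hd k s hs.1).mono Set.Icc_subset_Ici_self
    exact (((hasDerivWithinAt_id s _).const_mul lam).const_add _).sub h1
  have := nonneg_of_deriv hder (by
    intro s hs
    rw [htel]
    have hEs := hE s hs.1
    have g0 := (gg_mem (n := n) hEs 0).2
    have gK := (gg_mem (n := n) hEs K).1
    have hm : z (K+1) s ≤ z 1 s := memE_anti hEs (by omega)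
    nlinarith) (by
    have := hs.sum_le_tsum (Finset.range K) (fun k _ => ((hE 0 le_rfl).2.2 (k+1)).1)
    simp only [mul_zero, add_zero]; linarith) t ⟨ht, le_rfl⟩
  linarith

/-- For every z(0) ∈ D, the differential equation ż = v(z) has a
unique solution in D starting from z(0). -/
theorem stmt0 (lam : ℝ) (hlam0 : 0 < lam) (hlam1 : lam < 1) (n : ℕ) (hn : 1 ≤ n)
    (z0 : ℕ → ℝ) (hz0 : memD z0) :
    ∃ z : ℕ → ℝ → ℝ, (IsSolution lam n z ∧ ∀ k, z k 0 = z0 k) ∧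
      ∀ w : ℕ → ℝ → ℝ, IsSolution lam n w → (∀ k, w k 0 = z0 k) →
        ∀ k, 1 ≤ k → ∀ t : ℝ, 0 ≤ t → w k t = z k t := by
  obtain ⟨z, hE, hd, h0⟩ := sol_global hlam0 hlam1 n z0 (memE_of_memD hz0)
  refine ⟨z, ⟨⟨fun t ht => ?_, ?_⟩, h0⟩, ?_⟩
  · refine ⟨(hE t ht).1, (hE t ht).2.1, (hE t ht).2.2,
      sol_summable hlam0 hlam1 hE hd ?_ t ht⟩
    simp only [h0]; exact hz0.2.2.2
  · intro k hk t ht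
    obtain ⟨j, rfl⟩ : ∃ j, k = j + 1 := ⟨k - 1, by omega⟩
    exact hd j t ht
  · intro w hw hw0 k _ t ht
    have h1 : SolOn lam n t z := ⟨fun s hs => hE s hs.1, fun k s hs =>
      (hd k s hs.1).mono Set.Icc_subset_Ici_self⟩
    have h2 : SolOn lam n t w := ⟨fun s hs => memE_of_memD (hw.1 s hs.1), fun k s hs =>
      (hw.2 (k+1) (by omega) s hs.1).mono Set.Icc_subset_Ici_self⟩
    exact sol_unique hlam0 hlam1 h2 h1 (fun k => by rw [hw0, h0]) t ⟨ht, le_rfl⟩ k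

end
end

section
/- If (z(t))_{t≥0} is a solution of ż = v(z) in D with z_k(0) ≤ a_k for all k ≥ 1, then z_k(t) ≤ a_k for all k ≥ 1 and all t ≥ 0. -/
open Filter

noncomputable section

/-- Tangent-line inequality for powers. -/
theorem aux_tangent (n : ℕ) (x y : ℝ) (hx : 0 ≤ x) (hxy : x ≤ y) :
    (n : ℝ) * (y - x) * x ^ (n - 1) ≤ y ^ n - x ^ n := by
  induction n with
  | zero => simp
  | succ m ih =>
    rcases Nat.eq_zero_or_pos m with h | h
    · subst h; simp
    · obtain ⟨l, rfl⟩ : ∃ l, m = l + 1 := ⟨m - 1, by omega⟩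
      simp only [Nat.add_sub_cancel] at ih ⊢
      have h1 : x ^ (l + 1) ≤ y ^ (l + 1) := pow_le_pow_left₀ hx hxy _
      have h2 := mul_le_mul_of_nonneg_left ih hx
      have h3 := mul_le_mul_of_nonneg_left h1 (sub_nonneg.2 hxy)
      push_cast at h2 ⊢
      have e1 : x ^ (l + 1) = x * x ^ l := by ring
      have e2 : y ^ (l + 1 + 1) = y * y ^ (l + 1) := by ring
      have e3 : x ^ (l + 1 + 1) = x * x ^ (l + 1) := by ring
      rw [e2, e3]
      have e4 : x * (((l : ℝ) + 1) * (y - x) * x ^ l)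
        = ((l : ℝ) + 1) * (y - x) * x ^ (l + 1) := by ring
      rw [e4] at h2
      nlinarith

/-- The denominator. -/
def hden (n : ℕ) (y x : ℝ) : ℝ := 1 - (n : ℝ) * (y - x) * x ^ (n - 1)

/-- The factor as a function of two variables. -/
def hfac (n : ℕ) (y x : ℝ) : ℝ :=
  if x ^ n = 0 ∧ hden n y x = 0 then 1 else x ^ n / hden n y x

theorem muFactor_eq (n : ℕ) (z : ℕ → ℝ) (j : ℕ) : muFactor n z j = hfac n (z j) (z (j + 1)) := rfl

theorem hden_ge (n : ℕ) (x y : ℝ) (hx : 0 ≤ x) (hxy : x ≤ y) (hy : y ≤ 1) :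
    x ^ n ≤ hden n y x := by
  have h := aux_tangent n x y hx hxy
  have h2 : y ^ n ≤ 1 := pow_le_one₀ (hx.trans hxy) hy
  unfold hden; linarith

theorem hfac_pos_eq (n : ℕ) (x y : ℝ) (hx : 0 < x) :
    hfac n y x = x ^ n / hden n y x := by
  unfold hfac
  rw [if_neg]
  rintro ⟨h, -⟩
  exact (pow_pos hx n).ne' h

theorem hfac_nonneg (n : ℕ) (x y : ℝ) (hx : 0 ≤ x) (hxy : x ≤ y) (hy : y ≤ 1) :
    0 ≤ hfac n y x := by
  unfold hfac
  split_ifs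
  · exact zero_le_one
  · exact div_nonneg (pow_nonneg hx n) ((pow_nonneg hx n).trans (hden_ge n x y hx hxy hy))

theorem hfac_le_one (n : ℕ) (x y : ℝ) (hx : 0 ≤ x) (hxy : x ≤ y) (hy : y ≤ 1) :
    hfac n y x ≤ 1 := by
  unfold hfac
  split_ifs
  · exact le_rfl
  · exact div_le_one_of_le₀ (hden_ge n x y hx hxy hy)
      ((pow_nonneg hx n).trans (hden_ge n x y hx hxy hy))

theorem hden_anti (n : ℕ) (x y y' : ℝ) (hx : 0 ≤ x) (hyy : y ≤ y') :
    hden n y' x ≤ hden n y x := by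
  unfold hden
  have : (n : ℝ) * (y - x) * x ^ (n - 1) ≤ (n : ℝ) * (y' - x) * x ^ (n - 1) := by
    gcongr
  linarith

theorem hfac_zero (n : ℕ) (hn : 1 ≤ n) (y : ℝ) :
    hfac n y 0 = if n = 1 ∧ y = 1 then 1 else 0 := by
  unfold hfac
  have h0 : (0 : ℝ) ^ n = 0 := zero_pow (by omega)
  rw [h0]
  by_cases h1 : n = 1
  · subst h1
    by_cases hy : y = 1
    · simp [hden, hy]
    · have : ¬ (1 - y = 0) := fun h => hy (by linarith)
      simp [hden, hy, this]
  · have h2 : (0 : ℝ) ^ (n - 1) = 0 := zero_pow (by omega)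
    simp [hden, h1, h2]

theorem hfac_mono_left (n : ℕ) (hn : 1 ≤ n) (x y y' : ℝ) (hx : 0 ≤ x) (hxy : x ≤ y) (hyy : y ≤ y')
    (hy : y' ≤ 1) : hfac n y x ≤ hfac n y' x := by
  rcases hx.eq_or_lt with h | h
  · subst h
    rw [hfac_zero n hn, hfac_zero n hn]
    split_ifs with h1 h2 h2
    · exact le_rfl
    · exact absurd ⟨h1.1, le_antisymm hy (h1.2 ▸ hyy)⟩ h2
    · exact zero_le_one
    · exact le_rfl
  · rw [hfac_pos_eq n x y h, hfac_pos_eq n x y' h]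
    have := hden_ge n x y' hx (hxy.trans hyy) hy
    have hp := pow_pos h n
    exact div_le_div_of_nonneg_left hp.le (hp.trans_le this) (hden_anti n x y y' hx hyy)

theorem hfac_mono_right (n : ℕ) (hn : 1 ≤ n) (x x' y : ℝ) (hx : 0 ≤ x) (hxx : x ≤ x') (hxy : x' ≤ y)
    (hy : y ≤ 1) : hfac n y x ≤ hfac n y x' := by
  rcases hx.eq_or_lt with h | h
  · subst h
    rw [hfac_zero n hn]
    split_ifs with h1
    · obtain ⟨rfl, rfl⟩ := h1
      rcases hxx.eq_or_lt with h | h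
      · subst h; rw [hfac_zero 1 hn]; simp
      · rw [hfac_pos_eq 1 x' 1 h]
        simp [hden, h.ne']
    · exact hfac_nonneg n x' y hxx hxy hy
  · have h' : 0 < x' := h.trans_le hxx
    rw [hfac_pos_eq n x y h, hfac_pos_eq n x' y h']
    have d1 := (pow_pos h n).trans_le (hden_ge n x y hx (hxx.trans hxy) hy)
    have d2 := (pow_pos h' n).trans_le (hden_ge n x' y h'.le hxy hy)
    rw [div_le_div_iff₀ d1 d2]
    -- tangent inequality for the inverses
    have hs : x'⁻¹ ≤ x⁻¹ := inv_anti₀ h hxx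
    have hs1 : 1 ≤ x'⁻¹ := (one_le_inv₀ h').2 (hxy.trans hy)
    have ht := aux_tangent n x'⁻¹ x⁻¹ (by positivity) hs
    have hp1 : 1 ≤ x'⁻¹ ^ (n - 1) := one_le_pow₀ hs1
    have hk : (n : ℝ) * y * (x⁻¹ - x'⁻¹) ≤ x⁻¹ ^ n - x'⁻¹ ^ n := by
      refine le_trans ?_ ht
      have h5 : y ≤ x'⁻¹ ^ (n - 1) := hy.trans hp1
      have h6 : 0 ≤ (n : ℝ) * (x⁻¹ - x'⁻¹) := mul_nonneg (Nat.cast_nonneg _) (sub_nonneg.2 hs)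
      nlinarith [mul_le_mul_of_nonneg_left h5 h6]
    have hmul := mul_le_mul_of_nonneg_left hk (mul_pos (pow_pos h n) (pow_pos h' n)).le
    obtain ⟨m, rfl⟩ : ∃ m, n = m + 1 := ⟨n - 1, by omega⟩
    have e1 : x ^ (m+1) * x' ^ (m+1) * (x⁻¹ ^ (m+1) - x'⁻¹ ^ (m+1))
        = x' ^ (m+1) - x ^ (m+1) := by
      rw [inv_pow, inv_pow]
      field_simp
    have e2 : x ^ (m+1) * x' ^ (m+1) * (((m+1 : ℕ) : ℝ) * y * (x⁻¹ - x'⁻¹))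
        = ((m+1 : ℕ) : ℝ) * y * (x ^ m * x' ^ (m+1) - x ^ (m+1) * x' ^ m) := by
      field_simp
      ring
    rw [e1, e2] at hmul
    unfold hden
    simp only [Nat.add_sub_cancel]
    have e3 : x ^ (m+1) * x' ^ m * x' = x ^ (m+1) * x' ^ (m+1) := by ring
    have e4 : x' ^ (m+1) * x ^ m * x = x ^ (m+1) * x' ^ (m+1) := by ring
    linear_combination hmul + ((m+1 : ℕ) : ℝ) * (e3 - e4)

theorem hfac_mono (n : ℕ) (hn : 1 ≤ n) (x y x' y' : ℝ) (hx : 0 ≤ x) (hxy : x ≤ y)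
    (hxx : x ≤ x') (hyy : y ≤ y') (hxy' : x' ≤ y') (hy : y' ≤ 1) :
    hfac n y x ≤ hfac n y' x' :=
  (hfac_mono_left n hn x y y' hx hxy hyy hy).trans (hfac_mono_right n hn x x' y' hx hxx hxy' hy)

/-- Bracket monotonicity. -/
theorem bracket_mono (n : ℕ) (hn : 1 ≤ n) (x y y' : ℝ) (hx : 0 ≤ x) (hxy : x ≤ y) (hyy : y ≤ y')
    (hy : y' ≤ 1) : y ^ n - x ^ n * hfac n y x ≤ y' ^ n - x ^ n * hfac n y' x := by
  rcases hx.eq_or_lt with h | h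
  · subst h
    rw [zero_pow (by omega : n ≠ 0)]
    simpa using pow_le_pow_left₀ hxy hyy n
  · rw [hfac_pos_eq n x y h, hfac_pos_eq n x y' h]
    have hp := pow_pos h n
    have g1 := hden_ge n x y hx hxy (hyy.trans hy)
    have g2 := hden_ge n x y' hx (hxy.trans hyy) hy
    have d1 := hp.trans_le g1
    have d2 := hp.trans_le g2
    have ht := aux_tangent n y y' (hx.trans hxy) hyy
    have hpw : x ^ (n - 1) ≤ y ^ (n - 1) := pow_le_pow_left₀ hx hxy _
    have hnn : 0 ≤ (n : ℝ) * (y' - y) := mul_nonneg (Nat.cast_nonneg _) (sub_nonneg.2 hyy)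
    have h1 := mul_le_mul_of_nonneg_left hpw hnn
    have key : x ^ n * (x ^ n / hden n y' x) - x ^ n * (x ^ n / hden n y x)
        = (x ^ n / hden n y x) * (x ^ n / hden n y' x) * ((n : ℝ) * (y' - y) * x ^ (n - 1)) := by
      have : (n : ℝ) * (y' - y) * x ^ (n - 1) = hden n y x - hden n y' x := by
        unfold hden; ring
      rw [this]
      field_simp
    have q1 : x ^ n / hden n y x ≤ 1 := div_le_one_of_le₀ g1 d1.le
    have q2 : x ^ n / hden n y' x ≤ 1 := div_le_one_of_le₀ g2 d2.le
    have q3 : (x ^ n / hden n y x) * (x ^ n / hden n y' x) ≤ 1 :=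
      mul_le_one₀ q1 (div_nonneg hp.le d2.le) q2
    have q4 := mul_le_mul_of_nonneg_right q3 (mul_nonneg hnn (pow_nonneg hx (n - 1)))
    linarith

/-- Monotone sequences from one with values in the unit interval (no summability). -/
structure Good (z : ℕ → ℝ) : Prop where
  zero : z 0 = 1
  anti : ∀ k, z (k + 1) ≤ z k
  nonneg : ∀ k, 0 ≤ z k
  le_one : ∀ k, z k ≤ 1

theorem mu_nonneg (n : ℕ) (z : ℕ → ℝ) (hz : Good z) (k : ℕ) : 0 ≤ mu n z k :=
  Finset.prod_nonneg fun j _ => by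
    rw [muFactor_eq]; exact hfac_nonneg n _ _ (hz.nonneg _) (hz.anti _) (hz.le_one _)

theorem mu_mono (n : ℕ) (hn : 1 ≤ n) (z w : ℕ → ℝ) (hz : Good z) (hw : Good w)
    (h : ∀ k, z k ≤ w k) (k : ℕ) : mu n z k ≤ mu n w k :=
  Finset.prod_le_prod
    (fun j _ => by
      rw [muFactor_eq]; exact hfac_nonneg n _ _ (hz.nonneg _) (hz.anti _) (hz.le_one _))
    (fun j _ => by
      rw [muFactor_eq, muFactor_eq]
      exact hfac_mono n hn _ _ _ _ (hz.nonneg _) (hz.anti _) (h _) (h _) (hw.anti _) (hw.le_one _))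

theorem F_mono (lam : ℝ) (hlam0 : 0 < lam) (n : ℕ) (hn : 1 ≤ n) (z w : ℕ → ℝ) (hz : Good z)
    (hw : Good w) (h : ∀ k, z k ≤ w k) (k : ℕ) :
    lam * z k ^ n * mu n z k ≤ lam * w k ^ n * mu n w k := by
  have h1 := mu_mono n hn z w hz hw h k
  have h2 := mu_nonneg n z hz k
  have h3 := pow_le_pow_left₀ (hz.nonneg k) (h k) n
  have h4 := pow_nonneg (hw.nonneg k) n
  exact mul_le_mul (mul_le_mul_of_nonneg_left h3 hlam0.le) h1 h2 (mul_nonneg hlam0.le h4)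

theorem v_mono_s16 (lam : ℝ) (hlam0 : 0 < lam) (n : ℕ) (hn : 1 ≤ n) (z w : ℕ → ℝ) (hz : Good z)
    (hw : Good w) (h : ∀ k, z k ≤ w k) (k : ℕ) (hk : z (k + 1) = w (k + 1)) :
    vfield lam n z (k + 1) ≤ vfield lam n w (k + 1) := by
  unfold vfield
  simp only [Nat.add_sub_cancel]
  have e : ∀ u : ℕ → ℝ, mu n u (k + 1) = mu n u k * hfac n (u k) (u (k + 1)) := fun u => by
    unfold mu; rw [Finset.prod_range_succ, muFactor_eq]
  rw [e z, e w, hk]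
  have hb := bracket_mono n hn (w (k + 1)) (z k) (w k) (hw.nonneg _) (hk ▸ hz.anti k) (h k)
    (hw.le_one k)
  have hb0 : 0 ≤ z k ^ n - w (k + 1) ^ n * hfac n (z k) (w (k + 1)) := by
    rw [← hk]
    have h1 := hfac_le_one n _ _ (hz.nonneg (k + 1)) (hz.anti k) (hz.le_one k)
    have h2 := pow_le_pow_left₀ (hz.nonneg (k + 1)) (hz.anti k) n
    have h3 := pow_nonneg (hz.nonneg (k + 1)) n
    nlinarith
  have hm := mu_mono n hn z w hz hw h k
  have hm0 := mu_nonneg n z hz k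
  have hprod := mul_le_mul hm hb hb0 (hm0.trans hm)
  have hl := mul_le_mul_of_nonneg_left hprod hlam0.le
  have := h (k + 1 + 1)
  linear_combination hl + this

theorem a_good (lam : ℝ) (hlam0 : 0 < lam) (hlam1 : lam < 1) (n : ℕ) (hn : 1 ≤ n)
    (a : ℕ → ℝ) (ha0 : a 0 = 1)
    (harec : ∀ k, a (k + 1) = lam * a k ^ n * mu n a k) : Good a := by
  have H : ∀ k, 0 ≤ mu n a k ∧ 0 ≤ a (k + 1) ∧ a (k + 1) ≤ a k ∧ a k ≤ 1 := by
    intro k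
    induction k with
    | zero =>
      have h1 := harec 0
      simp [mu, ha0] at h1
      refine ⟨by simp [mu], ?_, ?_, ?_⟩ <;> (try rw [zero_add]) <;> linarith
    | succ k ih =>
      obtain ⟨i1, i2, i3, i4⟩ := ih
      have e : mu n a (k + 1) = mu n a k * hfac n (a k) (a (k + 1)) := by
        unfold mu; rw [Finset.prod_range_succ, muFactor_eq]
      have f0 := hfac_nonneg n _ _ i2 i3 i4
      have f1 := hfac_le_one n _ _ i2 i3 i4
      have m0 : 0 ≤ mu n a (k + 1) := by rw [e]; exact mul_nonneg i1 f0
      have m1 : mu n a (k + 1) ≤ mu n a k := by rw [e]; exact mul_le_of_le_one_right i1 f1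
      have p := pow_le_pow_left₀ i2 i3 n
      have p0 := pow_nonneg i2 n
      refine ⟨m0, ?_, ?_, i3.trans i4⟩
      · rw [harec (k + 1)]; exact mul_nonneg (mul_nonneg hlam0.le p0) m0
      · calc a (k + 1 + 1) = lam * a (k + 1) ^ n * mu n a (k + 1) := harec (k + 1)
          _ ≤ lam * a k ^ n * mu n a k :=
            mul_le_mul (mul_le_mul_of_nonneg_left p hlam0.le) m1 m0
              (mul_nonneg hlam0.le (p0.trans p))
          _ = a (k + 1) := (harec k).symm
  refine ⟨ha0, fun k => (H k).2.2.1, fun k => ?_, fun k => (H k).2.2.2⟩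
  exact (H k).2.1.trans (H k).2.2.1

theorem v_a (lam : ℝ) (n : ℕ) (a : ℕ → ℝ)
    (harec : ∀ k, a (k + 1) = lam * a k ^ n * mu n a k) (k : ℕ) :
    vfield lam n a (k + 1) = 0 := by
  unfold vfield
  simp only [Nat.add_sub_cancel]
  rw [← harec k, ← harec (k + 1)]; ring

theorem v_sum (lam : ℝ) (n : ℕ) (w : ℕ → ℝ) (hw0 : w 0 = 1) (m : ℕ) :
    ∑ k ∈ Finset.range m, vfield lam n w (k + 1)
      = lam - lam * w m ^ n * mu n w m - w 1 + w (m + 1) := by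
  induction m with
  | zero => simp [mu, hw0]
  | succ m ih =>
    rw [Finset.sum_range_succ, ih]
    unfold vfield
    simp only [Nat.add_sub_cancel]
    ring

/-- Right derivative of the positive part at a zero. -/
theorem deriv_pos_part (f : ℝ → ℝ) (v t : ℝ) (hf : HasDerivWithinAt f v (Set.Ici t) t) :
    ∃ d, HasDerivWithinAt (fun s => max (f s) 0) d (Set.Ici t) t ∧
      ((0 < f t ∧ d = v) ∨ (f t = 0 ∧ d = max v 0) ∨ (f t < 0 ∧ d = 0)) := by
  rcases lt_trichotomy (f t) 0 with h | h | h
  · refine ⟨0, ?_, Or.inr (Or.inr ⟨h, rfl⟩)⟩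
    refine (hasDerivWithinAt_const t (Set.Ici t) (0 : ℝ)).congr_of_eventuallyEq ?_
      (max_eq_right h.le)
    filter_upwards [hf.continuousWithinAt.eventually (gt_mem_nhds h)] with s hs
    exact max_eq_right hs.le
  · refine ⟨max v 0, ?_, Or.inr (Or.inl ⟨h, rfl⟩)⟩
    rw [← hasDerivWithinAt_Ioi_iff_Ici] at hf ⊢
    rw [hasDerivWithinAt_iff_tendsto_slope' (by simp)] at hf ⊢
    have := hf.max (tendsto_const_nhds (x := (0 : ℝ)))
    refine this.congr' ?_
    filter_upwards [self_mem_nhdsWithin] with s hs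
    have hs' : 0 < s - t := sub_pos.2 hs
    rw [slope_def_field, slope_def_field, h]
    simp only [sub_zero, max_self]
    rw [← max_div_div_right hs'.le, zero_div]
  · refine ⟨v, ?_, Or.inl ⟨h, rfl⟩⟩
    refine hf.congr_of_eventuallyEq ?_ (max_eq_left h.le)
    filter_upwards [hf.continuousWithinAt.eventually (lt_mem_nhds h)] with s hs
    exact max_eq_left hs.le

/-- if z solves ż = v(z) in D with z_k(0) ≤ a_k for all k ≥ 1,
then z_k(t) ≤ a_k for all k ≥ 1 and t ≥ 0. -/
theorem stmt16 (lam : ℝ) (hlam0 : 0 < lam) (hlam1 : lam < 1) (n : ℕ) (hn : 1 ≤ n)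
    (a : ℕ → ℝ) (ha0 : a 0 = 1)
    (harec : ∀ k, a (k + 1) = lam * a k ^ n * mu n a k)
    (z : ℕ → ℝ → ℝ) (hz : IsSolution lam n z)
    (h0 : ∀ k, 1 ≤ k → z k 0 ≤ a k) :
    ∀ k, 1 ≤ k → ∀ t : ℝ, 0 ≤ t → z k t ≤ a k := by
  have hA := a_good lam hlam0 hlam1 n hn a ha0 harec
  obtain ⟨hD, hder⟩ := hz
  have hZ : ∀ t, 0 ≤ t → Good (fun k => z k t) := fun t ht =>
    ⟨(hD t ht).1, (hD t ht).2.1, fun k => ((hD t ht).2.2.1 k).1, fun k => ((hD t ht).2.2.1 k).2⟩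
  have hcont : ∀ k, ContinuousOn (z (k + 1)) (Set.Ici 0) := fun k t ht =>
    (hder (k + 1) (by omega) t ht).continuousWithinAt
  have hq : ∀ k, Continuous (fun s => z (k + 1) (max s 0)) := fun k =>
    (hcont k).comp_continuous (by fun_prop) (fun s => Set.mem_Ici.2 (le_max_right _ _))
  -- the pointwise derivative estimate
  have hpt : ∀ t, 0 ≤ t → ∃ d : ℕ → ℝ, (∀ k, HasDerivWithinAt
      (fun s => max (z (k + 1) s - a (k + 1)) 0) (d k) (Set.Ici t) t) ∧
      ∀ m, ∑ k ∈ Finset.range m, d k ≤ z (m + 1) t := by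
    intro t ht
    have hg := hZ t ht
    set x : ℕ → ℝ := fun k => z k t with hx
    set w : ℕ → ℝ := fun k => max (x k) (a k) with hw
    have hW : Good w := ⟨by simp [hw, hg.zero, ha0], fun k => max_le_max (hg.anti k) (hA.anti k),
      fun k => le_max_of_le_left (hg.nonneg k), fun k => max_le (hg.le_one k) (hA.le_one k)⟩
    have hxw : ∀ k, x k ≤ w k := fun k => le_max_left _ _
    have haw : ∀ k, a k ≤ w k := fun k => le_max_right _ _
    have h1 : ∀ k, HasDerivWithinAt (fun s => z (k + 1) s - a (k + 1))
        (vfield lam n x (k + 1)) (Set.Ici t) t := fun k =>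
      ((hder (k + 1) (by omega) t ht).mono (Set.Ici_subset_Ici.2 ht)).sub_const _
    choose d hd hd' using fun k => deriv_pos_part _ _ _ (h1 k)
    refine ⟨d, hd, fun m => ?_⟩
    have hle : ∀ k, d k ≤ vfield lam n w (k + 1) := by
      intro k
      have up : a (k + 1) ≤ x (k + 1) → vfield lam n x (k + 1) ≤ vfield lam n w (k + 1) :=
        fun h => v_mono_s16 lam hlam0 n hn x w hg hW hxw k (max_eq_left h).symm
      have dn : x (k + 1) ≤ a (k + 1) → 0 ≤ vfield lam n w (k + 1) := fun h => by
        rw [← v_a lam n a harec k]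
        exact v_mono_s16 lam hlam0 n hn a w hA hW haw k (max_eq_right h).symm
      rcases hd' k with ⟨h, e⟩ | ⟨h, e⟩ | ⟨h, e⟩
      · rw [e]; exact up (sub_nonneg.1 h.le)
      · rw [e]; exact max_le (up (sub_nonneg.1 h.ge)) (dn (sub_nonpos.1 h.le))
      · rw [e]; exact dn (sub_nonpos.1 h.le)
    refine (Finset.sum_le_sum fun k _ => hle k).trans ?_
    rw [v_sum lam n w hW.zero]
    have hF := F_mono lam hlam0 n hn a w hA hW haw m
    rw [← harec m] at hF
    have ha1 : a 1 = lam := by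
      have := harec 0
      simpa [mu, ha0] using this
    have hw1 := haw 1
    have hlast : w (m + 1) ≤ x (m + 1) + a (m + 1) :=
      max_le (by linarith [hA.nonneg (m + 1)]) (by linarith [hg.nonneg (m + 1)])
    have : x (m + 1) = z (m + 1) t := rfl
    linarith
  -- the integrated estimate
  have hint : ∀ m t, 0 ≤ t → ∑ k ∈ Finset.range m, max (z (k + 1) t - a (k + 1)) 0
      ≤ ∫ s in (0 : ℝ)..t, z (m + 1) (max s 0) := by
    intro m t ht
    choose! d hd hds using hpt
    refine image_le_of_deriv_right_le_deriv_boundary (a := 0) (b := t)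
      (f := fun s => ∑ k ∈ Finset.range m, max (z (k + 1) s - a (k + 1)) 0)
      (f' := fun s => ∑ k ∈ Finset.range m, d s k)
      (B := fun t => ∫ s in (0 : ℝ)..t, z (m + 1) (max s 0))
      (B' := fun s => z (m + 1) (max s 0)) ?_ ?_ ?_ ?_ ?_ ?_ ⟨ht, le_rfl⟩
    · refine continuousOn_finsetSum _ fun k _ => ?_
      exact (((hcont k).mono Set.Icc_subset_Ici_self).sub continuousOn_const).sup continuousOn_const
    · intro s hs
      exact HasDerivWithinAt.fun_sum fun k _ => hd s hs.1 k
    · simp only [intervalIntegral.integral_same]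
      refine (Finset.sum_eq_zero fun k _ => ?_).le
      exact max_eq_right (sub_nonpos.2 (h0 (k + 1) (by omega)))
    · intro s _
      exact (intervalIntegral.continuous_primitive
        (fun a b => (hq m).intervalIntegrable a b) 0).continuousWithinAt
    · intro s _
      exact ((hq m).integral_hasStrictDerivAt 0 s).hasDerivAt.hasDerivWithinAt
    · intro s hs
      simp only [max_eq_left hs.1]
      exact hds s hs.1 m
  -- the limit
  intro k hk t ht
  obtain ⟨j, rfl⟩ : ∃ j, k = j + 1 := ⟨k - 1, by omega⟩
  have hlim : Tendsto (fun m => ∫ s in (0 : ℝ)..t, z (m + 1) (max s 0)) atTop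
      (nhds (∫ _ in (0 : ℝ)..t, (0 : ℝ))) := by
    refine intervalIntegral.tendsto_integral_filter_of_dominated_convergence (fun _ => (1 : ℝ))
      ?_ ?_ ?_ ?_
    · exact Eventually.of_forall fun m => (hq m).aestronglyMeasurable
    · refine Eventually.of_forall fun m => Eventually.of_forall fun s _ => ?_
      have hg := hZ (max s 0) (le_max_right _ _)
      rw [Real.norm_eq_abs, abs_of_nonneg (hg.nonneg (m + 1))]
      exact hg.le_one (m + 1)
    · exact intervalIntegrable_const
    · refine Eventually.of_forall fun s _ => ?_
      exact (hD (max s 0) (le_max_right _ _)).2.2.2.tendsto_atTop_zero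
  rw [intervalIntegral.integral_zero] at hlim
  have hfin : max (z (j + 1) t - a (j + 1)) 0 ≤ 0 := by
    refine ge_of_tendsto hlim ?_
    filter_upwards [eventually_gt_atTop j] with m hm
    refine le_trans ?_ (hint m t ht)
    exact Finset.single_le_sum (f := fun k => max (z (k + 1) t - a (k + 1)) 0)
      (fun i _ => le_max_right _ _) (Finset.mem_range.2 hm)
  exact sub_nonpos.1 ((le_max_left _ _).trans hfin)

end
end
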